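/- Let z = 3/5 + (4/5)·i and x_n = Re(z^n). Suppose m ∈ ℕ, M is a real m×m row-stochastic matrix (all entries nonnegative, each row summing to 1), and u, v ∈ ℝᵐ are vectors such that, setting y_n = uᵀ Mⁿ v, for all n ∈ ℕ one has y_n ≠ 1/4 and (x_n > 0 ⟺ y_n > 1/4). Then the sequence ⟨w_n⟩ with w_n = max(y_n, 1/4) is not a linear recurrence sequence: there is no order k ≥ 1 and coefficients b₀, …, b_{k−1} ∈ ℝ with w_{n+k} = b_{k−1}·w_{n+k−1} + ⋯ + b₀·w_n for all n ∈ ℕ. -/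

import Mathlib

open Matrix

open Polynomial in
/-- If a monic polynomial in `S` kills `x`, then so does a monic polynomial in `S ^ N`
of no larger degree. -/
theorem exists_monic_aeval_pow_apply_eq_zero {K V : Type*} [Field K] [AddCommGroup V] [Module K V]
    (S : Module.End K V) (x : V) {p : K[X]} (hp : p.Monic) (hx : aeval S p x = 0) (N : ℕ) :
    ∃ q : K[X], q.Monic ∧ q.natDegree ≤ p.natDegree ∧ aeval (S ^ N) q x = 0 := by
  have : Module.Finite K (AdjoinRoot p) := hp.finite_adjoinRoot
  refine ⟨minpoly K (AdjoinRoot.root p ^ N), minpoly.monic (Algebra.IsIntegral.isIntegral _),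
    (minpoly.natDegree_le _).trans_eq finrank_quotient_span_eq_natDegree, ?_⟩
  obtain ⟨r, hr⟩ : p ∣ (minpoly K (AdjoinRoot.root p ^ N)).comp (X ^ N) := by
    rw [← AdjoinRoot.mk_eq_zero, ← AdjoinRoot.aeval_eq, aeval_comp]
    simp
  have h : aeval S ((minpoly K (AdjoinRoot.root p ^ N)).comp (X ^ N)) x = 0 := by
    rw [hr, mul_comm, map_mul, Module.End.mul_apply, hx, map_zero]
  simpa [aeval_comp] using h

open Polynomial in
theorem apply_pow_eq_zero_of_forall_lt_natDegree {K V : Type*} [Field K] [AddCommGroup V]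
    [Module K V] (T : Module.End K V) (f : V →ₗ[K] K) (x : V) {q : K[X]} (hq : q.Monic)
    (hx : aeval T q x = 0) (h : ∀ j < q.natDegree, f ((T ^ j) x) = 0) (j : ℕ) :
    f ((T ^ j) x) = 0 := by
  induction j using Nat.strong_induction_on with
  | _ j ih =>
    rcases lt_or_ge j q.natDegree with hj | hj
    · exact h j hj
    obtain ⟨l, rfl⟩ := Nat.exists_eq_add_of_le hj
    have key : f ((T ^ l) (aeval T q x)) = 0 := by simp [hx]
    rw [aeval_eq_sum_range, Finset.sum_range_succ, hq.coeff_natDegree, one_smul] at key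
    simp only [LinearMap.add_apply, LinearMap.sum_apply, LinearMap.smul_apply, map_add, map_sum,
      map_smul, ← Module.End.mul_apply, ← pow_add] at key
    rw [Finset.sum_eq_zero, zero_add] at key
    · rwa [add_comm]
    · intro i hi
      rw [ih _ (by have := Finset.mem_range.1 hi; omega), smul_zero]

theorem exists_int_of_three_add_four_I_pow (n : ℕ) :
    ∃ a b : ℤ, (3 + 4 * Complex.I) ^ (n + 1) = a + b * Complex.I ∧ a % 5 = 3 ∧ b % 5 = 4 := by
  induction n with
  | zero => exact ⟨3, 4, by simp, by norm_num, by norm_num⟩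
  | succ n ih =>
    obtain ⟨a, b, h, ha, hb⟩ := ih
    refine ⟨3 * a - 4 * b, 4 * a + 3 * b, ?_, by omega, by omega⟩
    rw [pow_succ, h]
    push_cast
    linear_combination 4 * (b : ℂ) * Complex.I_sq

theorem im_pow_ne_zero {n : ℕ} (hn : n ≠ 0) :
    (((3 / 5 : ℂ) + (4 / 5) * Complex.I) ^ n).im ≠ 0 := by
  obtain ⟨n, rfl⟩ := Nat.exists_eq_succ_of_ne_zero hn
  obtain ⟨a, b, h, -, hb⟩ := exists_int_of_three_add_four_I_pow n
  intro h0
  have h1 : (3 + 4 * Complex.I) ^ (n + 1)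
      = ((5 ^ (n + 1) : ℝ) : ℂ) * ((3 / 5 : ℂ) + (4 / 5) * Complex.I) ^ (n + 1) := by
    push_cast
    rw [← mul_pow]
    ring
  have h2 := congrArg Complex.im (h1.symm.trans h)
  rw [Complex.im_ofReal_mul, h0] at h2
  have hb0 : b = 0 := by simpa [eq_comm] using h2
  omega

theorem norm_three_fifths_add_four_fifths_I : ‖(3 / 5 : ℂ) + (4 / 5) * Complex.I‖ = 1 := by
  have h : (3 / 5 : ℂ) + (4 / 5) * Complex.I = ((3 / 5 : ℝ) : ℂ) + ((4 / 5 : ℝ) : ℂ) * Complex.I := by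
    push_cast; rfl
  rw [h, Complex.norm_add_mul_I]
  norm_num

theorem exists_norm_pow_sub_one_lt {z : ℂ} (hz : ‖z‖ = 1) {ε : ℝ} (hε : 0 < ε) :
    ∃ N : ℕ, N ≠ 0 ∧ ‖z ^ N - 1‖ < ε := by
  obtain ⟨a, -, φ, hφ, hlim⟩ := (isCompact_sphere (0 : ℂ) 1).tendsto_subseq
    (x := fun n : ℕ => z ^ n) (by simp [hz])
  obtain ⟨K, hK⟩ := Metric.cauchySeq_iff'.1 hlim.cauchySeq ε hε
  have hlt : φ K < φ (K + 1) := hφ (Nat.lt_succ_self K)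
  refine ⟨φ (K + 1) - φ K, by omega, ?_⟩
  have h := hK (K + 1) (Nat.le_succ K)
  rw [dist_eq_norm] at h
  calc ‖z ^ (φ (K + 1) - φ K) - 1‖ = ‖z ^ φ K * (z ^ (φ (K + 1) - φ K) - 1)‖ := by
        simp [hz]
    _ = ‖z ^ φ (K + 1) - z ^ φ K‖ := by
        rw [mul_sub, ← pow_add, mul_one, Nat.add_sub_cancel' hlt.le]
    _ < ε := h

theorem norm_pow_sub_one_le {w : ℂ} (hw : ‖w‖ = 1) (j : ℕ) : ‖w ^ j - 1‖ ≤ j * ‖w - 1‖ := by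
  induction j with
  | zero => simp
  | succ j ih =>
    calc ‖w ^ (j + 1) - 1‖ = ‖w ^ j * (w - 1) + (w ^ j - 1)‖ := by ring_nf
      _ ≤ ‖w ^ j * (w - 1)‖ + ‖w ^ j - 1‖ := norm_add_le _ _
      _ ≤ ‖w - 1‖ + j * ‖w - 1‖ := by
        gcongr
        simp [hw]
      _ = ((j + 1 : ℕ) : ℝ) * ‖w - 1‖ := by push_cast; ring

open Filter Topology in
/-- A non-real rotation eventually moves any unit vector into the open right half-plane. -/
theorem exists_re_mul_pow_pos {c w : ℂ} (hc : ‖c‖ = 1) (hw : ‖w‖ = 1) (hwim : w.im ≠ 0) :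
    ∃ j : ℕ, 0 < (c * w ^ j).re := by
  by_contra! hneg
  have hw1 : w ≠ 1 := by rintro rfl; simp at hwim
  have hpos : 0 < ‖w - 1‖ := norm_pos_iff.2 (sub_ne_zero.2 hw1)
  have hsum : Summable fun j => -(c * w ^ j).re := by
    refine summable_of_sum_range_le (c := 2 / ‖w - 1‖) (fun j => by linarith [hneg j]) fun n => ?_
    calc ∑ j ∈ Finset.range n, -(c * w ^ j).re = -(c * ∑ j ∈ Finset.range n, w ^ j).re := by
          rw [Finset.mul_sum, Complex.re_sum, Finset.sum_neg_distrib]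
      _ ≤ ‖c * ∑ j ∈ Finset.range n, w ^ j‖ := (neg_le_abs _).trans (Complex.abs_re_le_norm _)
      _ = ‖w ^ n - 1‖ / ‖w - 1‖ := by rw [geom_sum_eq hw1, norm_mul, hc, one_mul, norm_div]
      _ ≤ 2 / ‖w - 1‖ := by
        gcongr
        refine (norm_sub_le _ _).trans_eq ?_
        simp [hw]
        norm_num
  have hre : Tendsto (fun j => (c * w ^ j).re) atTop (𝓝 0) := by
    simpa using hsum.tendsto_atTop_zero.neg
  have him : Tendsto (fun j => (c * w ^ j).im) atTop (𝓝 0) := by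
    have h := ((hre.mul_const w.re).sub (hre.comp (tendsto_add_atTop_nat 1))).div_const w.im
    simp only [zero_mul, sub_zero, zero_div] at h
    refine h.congr fun j => ?_
    have : (c * w ^ (j + 1)).re = (c * w ^ j).re * w.re - (c * w ^ j).im * w.im := by
      rw [pow_succ, ← mul_assoc, Complex.mul_re]
    simp only [Function.comp_apply, this]
    field_simp
    ring
  have hone : Tendsto (fun _ : ℕ => (1 : ℝ)) atTop (𝓝 0) := by
    have h := (hre.mul hre).add (him.mul him)
    simp only [mul_zero, add_zero] at h
    refine h.congr fun j => ?_
    rw [← Complex.normSq_apply, Complex.normSq_eq_norm_sq]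
    simp [hc, hw]
  exact one_ne_zero (tendsto_nhds_unique tendsto_const_nhds hone)

theorem re_mul_pow_neg {c w : ℂ} {d : ℕ} (hc : ‖c‖ = 1) (hw : ‖w‖ = 1)
    (h : d * ‖w - 1‖ < -c.re) {j : ℕ} (hj : j < d) : (c * w ^ j).re < 0 := by
  have h1 : (c * w ^ j).re - c.re ≤ ‖w ^ j - 1‖ := by
    calc (c * w ^ j).re - c.re = (c * (w ^ j - 1)).re := by
          rw [mul_sub, mul_one, Complex.sub_re]
      _ ≤ ‖c * (w ^ j - 1)‖ := Complex.re_le_norm _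
      _ = ‖w ^ j - 1‖ := by rw [norm_mul, hc, one_mul]
  have h2 : (j : ℝ) * ‖w - 1‖ ≤ d * ‖w - 1‖ := by gcongr
  linarith [norm_pow_sub_one_le hw j]

/-- The shift operator on real sequences. -/
def sequenceShift : Module.End ℝ (ℕ → ℝ) := LinearMap.funLeft ℝ ℝ Nat.succ

theorem sequenceShift_pow_apply (n : ℕ) (s : ℕ → ℝ) (j : ℕ) :
    (sequenceShift ^ n) s j = s (j + n) := by
  induction n generalizing j with
  | zero => rfl
  | succ n ih =>
    rw [pow_succ', Module.End.mul_apply, sequenceShift, LinearMap.funLeft_apply, ← sequenceShift,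
      ih]
    congr 1
    omega

open Polynomial in
theorem LinearRecurrence.IsSolution.aeval_charPoly_eq_zero {E : LinearRecurrence ℝ} {s : ℕ → ℝ}
    (hs : E.IsSolution s) : aeval sequenceShift E.charPoly s = 0 := by
  ext n
  simp [LinearRecurrence.charPoly, aeval_monomial, sequenceShift_pow_apply, hs n]

open Polynomial in
/-- No linear recurrence sequence has support equal to the set where the rotation lies in
the open right half-plane. -/
theorem not_forall_ne_zero_iff_re_pow_pos {p : ℝ[X]} (hp : p.Monic) {s : ℕ → ℝ}
    (hs : aeval sequenceShift p s = 0) :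
    ¬ ∀ n, s n ≠ 0 ↔ 0 < (((3 / 5 : ℂ) + (4 / 5) * Complex.I) ^ n).re := by
  intro hiff
  set z : ℂ := (3 / 5 : ℂ) + (4 / 5) * Complex.I with hzdef
  have hz : ‖z‖ = 1 := norm_three_fifths_add_four_fifths_I
  have hc : ‖z ^ 2‖ = 1 := by simp [hz]
  have hcre : (z ^ 2).re = -(7 / 25) := by
    have h : z ^ 2 = ((-(7 / 25) : ℝ) : ℂ) + ((24 / 25 : ℝ) : ℂ) * Complex.I := by
      rw [hzdef]
      push_cast
      linear_combination (16 / 25 : ℂ) * Complex.I_sq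
    rw [h]
    simp
  obtain ⟨N, hN, hNlt⟩ := exists_norm_pow_sub_one_lt hz
    (show (0 : ℝ) < 7 / 25 / (p.natDegree + 1) by positivity)
  have hw : ‖z ^ N‖ = 1 := by simp [hz]
  have hsmall : (p.natDegree : ℝ) * ‖z ^ N - 1‖ < -(z ^ 2).re := by
    rw [lt_div_iff₀ (by positivity)] at hNlt
    rw [hcre]
    nlinarith [norm_nonneg (z ^ N - 1)]
  have hpow (j : ℕ) : z ^ 2 * (z ^ N) ^ j = z ^ (2 + N * j) := by rw [pow_add, pow_mul]
  have happly (j : ℕ) :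
      LinearMap.proj (R := ℝ) (φ := fun _ : ℕ => ℝ) 2 (((sequenceShift ^ N) ^ j) s)
        = s (2 + N * j) := by
    rw [← pow_mul, LinearMap.proj_apply, sequenceShift_pow_apply]
  obtain ⟨q, hq, hqdeg, hqs⟩ := exists_monic_aeval_pow_apply_eq_zero sequenceShift s hp hs N
  have hzero (j : ℕ) : s (2 + N * j) = 0 := by
    rw [← happly]
    refine apply_pow_eq_zero_of_forall_lt_natDegree _ _ s hq hqs (fun i hi => ?_) j
    have hneg := re_mul_pow_neg hc hw hsmall (hi.trans_le hqdeg)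
    rw [hpow] at hneg
    rw [happly]
    exact not_not.1 (mt (hiff _).1 hneg.not_gt)
  obtain ⟨j, hj⟩ := exists_re_mul_pow_pos hc hw (im_pow_ne_zero hN)
  rw [hpow] at hj
  exact (hiff _).2 hj (hzero j)

/-- Let `z = 3/5 + (4/5)i` and `x_n = Re(z^n)`. If `M` is a row-stochastic real matrix and
`u, v` are vectors such that the sequence `y_n = uᵀ Mⁿ v` satisfies `y_n ≠ 1/4` and
`x_n > 0 ↔ y_n > 1/4` for all `n`, then the sequence `w_n = max (y_n) (1/4)` is not a
linear recurrence sequence. -/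
theorem stmt12 (m : ℕ) (M : Matrix (Fin m) (Fin m) ℝ)
    (hMnonneg : ∀ i j, 0 ≤ M i j) (hMrow : ∀ i, ∑ j, M i j = 1)
    (u v : Fin m → ℝ)
    (hne : ∀ n : ℕ, u ⬝ᵥ (M ^ n).mulVec v ≠ 1 / 4)
    (hiff : ∀ n : ℕ,
      0 < (((3 / 5 : ℂ) + (4 / 5) * Complex.I) ^ n).re ↔ 1 / 4 < u ⬝ᵥ (M ^ n).mulVec v) :
    ¬ ∃ k : ℕ, 1 ≤ k ∧ ∃ b : Fin k → ℝ, ∀ n : ℕ,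
        max (u ⬝ᵥ (M ^ (n + k)).mulVec v) (1 / 4)
          = ∑ i : Fin k, b i * max (u ⬝ᵥ (M ^ (n + (i : ℕ))).mulVec v) (1 / 4) := by
  rintro ⟨k, -, b, hb⟩
  let E : LinearRecurrence ℝ := ⟨k, b⟩
  let w : ℕ → ℝ := fun n => max (u ⬝ᵥ (M ^ n).mulVec v) (1 / 4)
  have hw : E.IsSolution w := hb
  let c : ℕ → ℝ := fun _ => 1 / 4
  have hconst : Polynomial.aeval sequenceShift (Polynomial.X - Polynomial.C 1 : Polynomial ℝ) c
      = 0 := by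
    ext n
    simp [sequenceShift, c]
  refine not_forall_ne_zero_iff_re_pow_pos (s := w - c)
    ((Polynomial.monic_X_sub_C (1 : ℝ)).mul E.charPoly_monic) ?_ fun n => ?_
  · rw [map_sub]
    nth_rewrite 2 [mul_comm]
    simp only [map_mul, Module.End.mul_apply, hw.aeval_charPoly_eq_zero, hconst, map_zero, sub_zero]
  · rw [hiff n, Pi.sub_apply, sub_ne_zero, ne_eq, max_eq_right_iff, not_le]
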